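/- (Theorem 2, part 2) Suppose p ∈ ℝ[x₁,…,xₙ] satisfies p = ∑_{i=1}^m f_i² for polynomials f₁,…,f_m. Then for every i, the Newton polytope of f_i is contained in the reduced Newton polytope of p: C(f_i) ⊆ (1/2)·C(p), where (1/2)·C(p) = { (1/2)·x : x ∈ C(p) } ⊆ ℝⁿ. -/

import Mathlib

open scoped Pointwise

/-- The natural embedding of an exponent vector `α ∈ ℕⁿ` as a point of `ℝⁿ`. -/
def expVec {n : ℕ} (α : Fin n →₀ ℕ) : Fin n → ℝ := fun i => (α i : ℝ)

theorem expVec_injective {n : ℕ} : Function.Injective (expVec (n := n)) := fun _ _ h =>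
  Finsupp.ext fun i => Nat.cast_injective (R := ℝ) (congrFun h i)

theorem expVec_add {n : ℕ} (α β : Fin n →₀ ℕ) : expVec (α + β) = expVec α + expVec β := by
  ext i; simp [expVec]

/-- If `α` is not the midpoint of two other exponents of `g`, then the coefficient of `g ^ 2` at
`2α` is the square of the coefficient of `g` at `α`. -/
theorem MvPolynomial.coeff_sq_add_self {n : ℕ} {g : MvPolynomial (Fin n) ℝ} {α : Fin n →₀ ℕ}
    (h : ∀ β ∈ g.support, ∀ γ ∈ g.support, β + γ = α + α → β = α) :
    (g ^ 2).coeff (α + α) = g.coeff α ^ 2 := by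
  rw [sq, MvPolynomial.coeff_mul, Finset.sum_eq_single (α, α), sq]
  · rintro ⟨β, γ⟩ hβγ hne
    rw [Finset.HasAntidiagonal.mem_antidiagonal] at hβγ
    by_contra h0
    have hβ := h β (MvPolynomial.mem_support_iff.2 (left_ne_zero_of_mul h0)) γ
      (MvPolynomial.mem_support_iff.2 (right_ne_zero_of_mul h0)) hβγ
    subst hβ
    exact hne (Prod.ext rfl (add_left_cancel hβγ))
  · simp

/-- An extreme point of a convex set is not the midpoint of two other points of the set. -/
theorem eq_of_add_eq_add_self_of_mem_extremePoints {E : Type*} [AddCommGroup E] [Module ℝ E]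
    {s : Set E} {x y z : E} (hx : x ∈ s.extremePoints ℝ) (hy : y ∈ s) (hz : z ∈ s)
    (h : y + z = x + x) : y = x := by
  refine hx.2 hy hz ⟨1 / 2, 1 / 2, by norm_num, by norm_num, by norm_num, ?_⟩
  rw [← smul_add, h, ← two_smul ℝ x, smul_smul]
  norm_num

/-- **Theorem 2, part 2.** If `p = ∑_{i=1}^m f_i²`, then for every `i` the Newton
polytope of `f i` is contained in the reduced Newton polytope `(1/2)·C(p)` of `p`. -/
theorem newton_polytope_subset (n m : ℕ) (p : MvPolynomial (Fin n) ℝ)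
    (f : Fin m → MvPolynomial (Fin n) ℝ)
    (hsos : p = ∑ i, (f i) ^ 2) :
    ∀ i : Fin m,
      convexHull ℝ (expVec '' ((f i).support : Set (Fin n →₀ ℕ))) ⊆
        (2⁻¹ : ℝ) • convexHull ℝ (expVec '' (p.support : Set (Fin n →₀ ℕ))) := by
  intro i
  set A : Set (Fin n →₀ ℕ) := ⋃ j, ((f j).support : Set (Fin n →₀ ℕ)) with hA
  have hAfin : A.Finite := Set.finite_iUnion fun j => (f j).support.finite_toSet
  have hcompact := (hAfin.image expVec).isCompact_convexHull (𝕜 := ℝ)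
  have hclosed : IsClosed ((2⁻¹ : ℝ) • convexHull ℝ (expVec '' (p.support : Set (Fin n →₀ ℕ)))) :=
    (((p.support.finite_toSet.image expVec).isCompact_convexHull (𝕜 := ℝ)).smul _).isClosed
  have hmem : ∀ j, ∀ β ∈ (f j).support, expVec β ∈ convexHull ℝ (expVec '' A) := fun j β hβ =>
    subset_convexHull ℝ _ (Set.mem_image_of_mem _ (Set.mem_iUnion.2 ⟨j, hβ⟩))
  refine (convexHull_mono (Set.image_mono
    (Set.subset_iUnion (fun j => ((f j).support : Set (Fin n →₀ ℕ))) i))).trans ?_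
  rw [← hA, ← closure_convexHull_extremePoints hcompact (convex_convexHull ℝ _)]
  refine closure_minimal (convexHull_min ?_ ((convex_convexHull ℝ _).smul _)) hclosed
  intro x hx
  obtain ⟨α, hα, rfl⟩ := extremePoints_convexHull_subset hx
  obtain ⟨k, hk⟩ := Set.mem_iUnion.1 hα
  have hcoeff : p.coeff (α + α) = ∑ j, (f j).coeff α ^ 2 := by
    rw [hsos, MvPolynomial.coeff_sum]
    refine Finset.sum_congr rfl fun j _ => MvPolynomial.coeff_sq_add_self fun β hβ γ hγ h => ?_
    refine expVec_injective (eq_of_add_eq_add_self_of_mem_extremePoints hx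
      (hmem j β hβ) (hmem j γ hγ) ?_)
    rw [← expVec_add, h, expVec_add]
  have hpos : 0 < p.coeff (α + α) := by
    rw [hcoeff]
    exact Finset.sum_pos' (fun j _ => sq_nonneg _)
      ⟨k, Finset.mem_univ k, sq_pos_of_ne_zero (MvPolynomial.mem_support_iff.1 hk)⟩
  refine ⟨expVec (α + α), subset_convexHull ℝ _
    (Set.mem_image_of_mem _ (MvPolynomial.mem_support_iff.2 hpos.ne')), ?_⟩
  change (2⁻¹ : ℝ) • expVec (α + α) = expVec α
  rw [expVec_add, ← two_smul ℝ, smul_smul]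
  norm_num
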